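/- Let E be a directed graph and C_K(E) the Cohn path algebra of E over a field K. Then the set {α β* : α, β finite paths in E with r(α) = r(β)} is a K-basis of C_K(E). -/

import Mathlib

/-- A directed graph: vertices, arrows, source and range maps. -/
structure Digraph' where
  V : Type
  A : Type
  s : A → V
  r : A → V

/-- Generators of the Cohn path algebra: vertices, real arrows, ghost arrows. -/
inductive CohnGen (G : Digraph') : Type
  | vert (v : G.V)
  | edge (a : G.A)
  | ghost (a : G.A)

open FreeAlgebra CohnGen in
/-- The defining relations of the Cohn path algebra `C_K(E)`: the path-algebra
relations of the extended graph `Ê` together with the Cuntz–Krieger relation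
(CK1). -/
inductive CohnRel (K : Type) [Field K] (G : Digraph')
    [DecidableEq G.V] [DecidableEq G.A] :
    FreeAlgebra K (CohnGen G) → FreeAlgebra K (CohnGen G) → Prop
  | vert_vert (v w : G.V) :
      CohnRel K G (ι K (vert v) * ι K (vert w))
        (if v = w then ι K (vert v) else 0)
  | vert_edge (v : G.V) (a : G.A) :
      CohnRel K G (ι K (vert v) * ι K (edge a))
        (if v = G.s a then ι K (edge a) else 0)
  | edge_vert (a : G.A) (v : G.V) :
      CohnRel K G (ι K (edge a) * ι K (vert v))
        (if G.r a = v then ι K (edge a) else 0)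
  | vert_ghost (v : G.V) (a : G.A) :
      CohnRel K G (ι K (vert v) * ι K (ghost a))
        (if v = G.r a then ι K (ghost a) else 0)
  | ghost_vert (a : G.A) (v : G.V) :
      CohnRel K G (ι K (ghost a) * ι K (vert v))
        (if G.s a = v then ι K (ghost a) else 0)
  | ck1 (a b : G.A) :
      CohnRel K G (ι K (ghost a) * ι K (edge b))
        (if a = b then ι K (vert (G.r a)) else 0)

/-- The Cohn path algebra `C_K(E)` (as the quotient of the free algebra on
vertices, arrows and ghost arrows by the relations `CohnRel`; since `E` may be
infinite, `C_K(E)` itself is the non-unital subalgebra generated by the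
images of the generators). -/
abbrev CohnAlg (K : Type) [Field K] (G : Digraph') [DecidableEq G.V] [DecidableEq G.A] :=
  RingQuot (CohnRel K G)

/-- A finite path in a directed graph: a source vertex and a composable list
of arrows starting at it (the empty list giving the path of length 0 at the
source vertex). -/
structure FPath (G : Digraph') where
  src : G.V
  arrows : List G.A
  hsrc : ∀ a, arrows.head? = some a → G.s a = src
  hchain : arrows.Chain' fun a b => G.s b = G.r a

/-- The range of a finite path. -/
def FPath.rng {G : Digraph'} (p : FPath G) : G.V :=
  match p.arrows.getLast? with
  | none => p.src
  | some a => G.r a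

/-- The element `α` of the Cohn path algebra given by a finite path `α`. -/
def realElem (K : Type) [Field K] (G : Digraph') [DecidableEq G.V] [DecidableEq G.A]
    (p : FPath G) : CohnAlg K G :=
  if p.arrows.isEmpty then
    RingQuot.mkAlgHom K (CohnRel K G) (FreeAlgebra.ι K (CohnGen.vert p.src))
  else
    RingQuot.mkAlgHom K (CohnRel K G)
      ((p.arrows.map fun a => FreeAlgebra.ι K (CohnGen.edge a)).prod)

/-- The element `β*` of the Cohn path algebra given by a finite path `β`
(the reversed ghost path). -/
def ghostElem (K : Type) [Field K] (G : Digraph') [DecidableEq G.V] [DecidableEq G.A]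
    (p : FPath G) : CohnAlg K G :=
  if p.arrows.isEmpty then
    RingQuot.mkAlgHom K (CohnRel K G) (FreeAlgebra.ι K (CohnGen.vert p.src))
  else
    RingQuot.mkAlgHom K (CohnRel K G)
      ((p.arrows.reverse.map fun a => FreeAlgebra.ι K (CohnGen.ghost a)).prod)

namespace CohnAlg

variable (K : Type) [Field K] {G : Digraph'}

/-- The list of arrows `l` is a path from `v` to `w`. -/
def IsWalk (G : Digraph') : G.V → List G.A → G.V → Prop
  | v, [], w => v = w
  | v, a :: l, w => G.s a = v ∧ IsWalk G (G.r a) l w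

theorem IsWalk.concat {v w : G.V} {l : List G.A} (h : IsWalk G v l w) {a : G.A}
    (ha : G.s a = w) : IsWalk G v (l ++ [a]) (G.r a) := by
  induction l generalizing v with
  | nil => exact ⟨ha.trans h.symm, rfl⟩
  | cons b l ih => exact ⟨h.1, ih h.2⟩

/-- The vertex at which a list of arrows followed by the vertex `w` starts. -/
def start (l : List G.A) (w : G.V) : G.V :=
  match l with
  | [] => w
  | a :: _ => G.s a

@[simp] theorem start_nil (w : G.V) : start [] w = w := rfl

@[simp] theorem start_cons (a : G.A) (l : List G.A) (w : G.V) : start (a :: l) w = G.s a := rfl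

theorem IsWalk.start_eq {v w : G.V} {l : List G.A} (h : IsWalk G v l w) : start l w = v := by
  cases l with
  | nil => exact h.symm
  | cons a l => exact h.1

theorem isWalk_fpath (p : FPath G) : IsWalk G p.src p.arrows p.rng := by
  obtain ⟨v, l, hs, hc⟩ := p
  induction l generalizing v with
  | nil => rfl
  | cons a l ih =>
    refine ⟨hs a rfl, ?_⟩
    have hc' := List.isChain_cons.1 hc
    have := ih (G.r a) (fun b hb => hc'.1 b hb) hc'.2
    cases l with
    | nil => exact this
    | cons b l => simpa [FPath.rng, List.getLast?_cons] using this

theorem IsWalk.eq_end {v w w' : G.V} {l : List G.A} (h : IsWalk G v l w)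
    (h' : IsWalk G v l w') : w = w' := by
  induction l generalizing v with
  | nil => exact h.symm.trans h'
  | cons a l ih => exact ih h.2 h'.2

theorem IsWalk.exists_fpath {v w : G.V} {l : List G.A} (h : IsWalk G v l w) :
    ∃ p : FPath G, p.src = v ∧ p.arrows = l ∧ p.rng = w := by
  suffices H : (∀ a, l.head? = some a → G.s a = v) ∧
      l.IsChain fun a b => G.s b = G.r a from
    ⟨⟨v, l, H.1, H.2⟩, rfl, rfl, (isWalk_fpath ⟨v, l, H.1, H.2⟩).eq_end h⟩
  induction l generalizing v with
  | nil => simp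
  | cons a l ih =>
    refine ⟨by simpa using h.1, List.isChain_cons.2 ⟨fun b hb => (ih h.2).1 b hb, (ih h.2).2⟩⟩

theorem fpath_ext {p q : FPath G} (h : p.arrows = q.arrows) (h' : p.rng = q.rng) : p = q := by
  have hp := (isWalk_fpath p).start_eq
  have hq := (isWalk_fpath q).start_eq
  have hs : p.src = q.src := by rw [← hp, ← hq, h, h']
  cases p; cases q; simp_all

variable [DecidableEq G.V] [DecidableEq G.A]

section Relations

/-- The class of a generator in the Cohn path algebra. -/
abbrev gen (g : CohnGen G) : CohnAlg K G :=
  RingQuot.mkAlgHom K (CohnRel K G) (FreeAlgebra.ι K g)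

open CohnGen

theorem vert_mul_vert (v w : G.V) :
    gen K (vert v) * gen K (vert w) = if v = w then gen K (vert v) else 0 := by
  have := RingQuot.mkAlgHom_rel K (CohnRel.vert_vert (K := K) v w)
  rw [map_mul] at this; rw [this]; split_ifs <;> simp

theorem vert_mul_edge (v : G.V) (a : G.A) :
    gen K (vert v) * gen K (edge a) = if v = G.s a then gen K (edge a) else 0 := by
  have := RingQuot.mkAlgHom_rel K (CohnRel.vert_edge (K := K) v a)
  rw [map_mul] at this; rw [this]; split_ifs <;> simp

theorem edge_mul_vert (a : G.A) (v : G.V) :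
    gen K (edge a) * gen K (vert v) = if G.r a = v then gen K (edge a) else 0 := by
  have := RingQuot.mkAlgHom_rel K (CohnRel.edge_vert (K := K) a v)
  rw [map_mul] at this; rw [this]; split_ifs <;> simp

theorem vert_mul_ghost (v : G.V) (a : G.A) :
    gen K (vert v) * gen K (ghost a) = if v = G.r a then gen K (ghost a) else 0 := by
  have := RingQuot.mkAlgHom_rel K (CohnRel.vert_ghost (K := K) v a)
  rw [map_mul] at this; rw [this]; split_ifs <;> simp

theorem ghost_mul_vert (a : G.A) (v : G.V) :
    gen K (ghost a) * gen K (vert v) = if G.s a = v then gen K (ghost a) else 0 := by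
  have := RingQuot.mkAlgHom_rel K (CohnRel.ghost_vert (K := K) a v)
  rw [map_mul] at this; rw [this]; split_ifs <;> simp

theorem ghost_mul_edge (a b : G.A) :
    gen K (ghost a) * gen K (edge b) = if a = b then gen K (vert (G.r a)) else 0 := by
  have := RingQuot.mkAlgHom_rel K (CohnRel.ck1 (K := K) a b)
  rw [map_mul] at this; rw [this]; split_ifs <;> simp

/-- The product of the arrows in a list. -/
def edges (l : List G.A) : CohnAlg K G := (l.map fun a => gen K (edge a)).prod

/-- The product of the ghost arrows of a list, in reversed order. -/
def ghosts (l : List G.A) : CohnAlg K G := (l.reverse.map fun a => gen K (ghost a)).prod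

@[simp] theorem edges_nil : edges K ([] : List G.A) = 1 := rfl

@[simp] theorem ghosts_nil : ghosts K ([] : List G.A) = 1 := rfl

theorem edges_cons (a : G.A) (l : List G.A) :
    edges K (a :: l) = gen K (edge a) * edges K l := by
  simp [edges]

theorem ghosts_cons (a : G.A) (l : List G.A) :
    ghosts K (a :: l) = ghosts K l * gen K (ghost a) := by
  simp [ghosts]

theorem ghosts_concat (l : List G.A) (a : G.A) :
    ghosts K (l ++ [a]) = gen K (ghost a) * ghosts K l := by
  simp [ghosts]

theorem realElem_eq (p : FPath G) :
    realElem K G p = gen K (vert p.src) * edges K p.arrows := by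
  obtain ⟨v, l, hs, hc⟩ := p
  cases l with
  | nil => simp [realElem]
  | cons a l =>
    have := hs a rfl
    simp [realElem, edges_cons, ← mul_assoc, vert_mul_edge, this]
    simp [edges, map_list_prod, Function.comp_def]

theorem ghostElem_eq (p : FPath G) :
    ghostElem K G p = ghosts K p.arrows * gen K (vert p.src) := by
  obtain ⟨v, l, hs, hc⟩ := p
  cases l with
  | nil => simp [ghostElem]
  | cons a l =>
    have := hs a rfl
    simp [ghostElem, ghosts_cons, mul_assoc, ghost_mul_vert, this]
    simp [ghosts, map_list_prod, Function.comp_def]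

end Relations

section Span

open CohnGen

variable (G) in
/-- The span of the elements `α β*` with `r(α) = r(β)`. -/
abbrev monomialSpan : Submodule K (CohnAlg K G) :=
  Submodule.span K (Set.range fun pq : {pq : FPath G × FPath G // pq.1.rng = pq.2.rng} =>
    realElem K G pq.1.1 * ghostElem K G pq.1.2)

theorem monomial_mem_span {v u w : G.V} {l m : List G.A} (hl : IsWalk G v l u)
    (hm : IsWalk G w m u) :
    gen K (vert v) * edges K l * (ghosts K m * gen K (vert w)) ∈ monomialSpan K G := by
  obtain ⟨p, rfl, rfl, hp⟩ := hl.exists_fpath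
  obtain ⟨q, rfl, rfl, hq⟩ := hm.exists_fpath
  exact Submodule.subset_span ⟨⟨(p, q), hp.trans hq.symm⟩, by simp only [realElem_eq, ghostElem_eq]⟩

theorem vert_mem_span (v : G.V) : gen K (vert v) ∈ monomialSpan K G := by
  simpa [vert_mul_vert] using
    monomial_mem_span K (show IsWalk G v [] v from rfl) (show IsWalk G v [] v from rfl)

theorem gen_mul_mem_span (g : CohnGen G) {x : CohnAlg K G} (hx : x ∈ monomialSpan K G) :
    gen K g * x ∈ monomialSpan K G := by
  induction hx using Submodule.span_induction with
  | zero => simp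
  | add x y _ _ hx hy => rw [mul_add]; exact add_mem hx hy
  | smul c x _ hx => rw [mul_smul_comm]; exact Submodule.smul_mem _ c hx
  | mem x hx =>
    obtain ⟨⟨⟨p, q⟩, hpq⟩, rfl⟩ := hx
    have hp := isWalk_fpath p
    have hq := isWalk_fpath q
    simp only at hpq
    rw [← hpq] at hq
    simp only [realElem_eq, ghostElem_eq]
    generalize p.rng = u at hp hq
    generalize p.src = v at hp
    generalize q.src = w at hq
    generalize p.arrows = l at hp
    generalize q.arrows = m at hq
    rw [← mul_assoc (gen K g), ← mul_assoc (gen K g)]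
    cases g with
    | vert x =>
      rw [vert_mul_vert]
      split_ifs with h
      · subst h; exact monomial_mem_span K hp hq
      · simp
    | edge a =>
      rw [edge_mul_vert]
      split_ifs with h
      · have := monomial_mem_span K (show IsWalk G (G.s a) (a :: l) u from ⟨rfl, h ▸ hp⟩) hq
        rwa [edges_cons, ← mul_assoc (gen K _) (gen K _), vert_mul_edge, if_pos rfl] at this
      · simp
    | ghost a =>
      cases l with
      | nil =>
        cases hp
        rw [ghost_mul_vert]
        split_ifs with h
        · have := monomial_mem_span K (show IsWalk G (G.r a) [] (G.r a) from rfl) (hq.concat h)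
          rw [ghosts_concat, edges_nil, mul_one, ← mul_assoc, ← mul_assoc, vert_mul_ghost,
            if_pos rfl] at this
          rwa [edges_nil, mul_one, ← mul_assoc]
        · simp
      | cons b l =>
        rw [edges_cons, ← mul_assoc (_ * _) (gen K (edge b)), mul_assoc _ _ (gen K (edge b)),
          vert_mul_edge, if_pos hp.1.symm, ghost_mul_edge]
        split_ifs with h
        · subst h; exact monomial_mem_span K hp.2 hq
        · simp

theorem gen_mem_span (g : CohnGen G) : gen K g ∈ monomialSpan K G := by
  cases g with
  | vert v => exact vert_mem_span K v
  | edge a =>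
    simpa [edge_mul_vert] using gen_mul_mem_span K (edge a) (vert_mem_span K (G.r a))
  | ghost a =>
    simpa [ghost_mul_vert] using gen_mul_mem_span K (ghost a) (vert_mem_span K (G.s a))

variable (G) in
theorem monomialSpan_eq_adjoin :
    monomialSpan K G =
      (NonUnitalAlgebra.adjoin K (Set.range fun g : CohnGen G => gen K g)).toSubmodule := by
  have hgen (g : CohnGen G) :
      gen K g ∈ NonUnitalAlgebra.adjoin K (Set.range fun g : CohnGen G => gen K g) :=
    NonUnitalAlgebra.subset_adjoin K ⟨g, rfl⟩
  apply le_antisymm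
  · rw [Submodule.span_le]
    rintro _ ⟨⟨⟨p, q⟩, -⟩, rfl⟩
    simp only [realElem_eq, ghostElem_eq]
    refine mul_mem (S := NonUnitalSubalgebra K (CohnAlg K G)) ?_ ?_
    · generalize vert p.src = g
      induction p.arrows generalizing g with
      | nil => simpa using hgen g
      | cons a l ih =>
        rw [edges_cons]
        exact mul_mem (S := NonUnitalSubalgebra K (CohnAlg K G)) (hgen g) (ih (edge a))
    · generalize vert q.src = g
      induction q.arrows generalizing g with
      | nil => simpa using hgen g
      | cons a l ih =>
        rw [ghosts_cons]
        exact mul_mem (S := NonUnitalSubalgebra K (CohnAlg K G)) (ih (ghost a)) (hgen g)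
  · intro x hx
    suffices H : x ∈ monomialSpan K G ∧ ∀ y ∈ monomialSpan K G, x * y ∈ monomialSpan K G from H.1
    induction hx using NonUnitalAlgebra.adjoin_induction with
    | mem x hx =>
      obtain ⟨g, rfl⟩ := hx
      exact ⟨gen_mem_span K g, fun y hy => gen_mul_mem_span K g hy⟩
    | add x y _ _ hx hy =>
      exact ⟨add_mem hx.1 hy.1, fun z hz => by
        rw [add_mul]; exact add_mem (hx.2 z hz) (hy.2 z hz)⟩
    | zero => simp
    | mul x y _ _ hx hy =>
      exact ⟨hx.2 y hy.1, fun z hz => by rw [mul_assoc]; exact hx.2 _ (hy.2 z hz)⟩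
    | smul c x _ hx =>
      exact ⟨Submodule.smul_mem _ c hx.1, fun z hz => by
        rw [smul_mul_assoc]; exact Submodule.smul_mem _ c (hx.2 z hz)⟩

end Span

section Representation

open CohnGen

variable (G) in
/-- A triple `(l, w, m)` stands for the monomial with real arrows `l` followed by the vertex `w`
and the ghost arrows `m`. -/
abbrev Word : Type := List G.A × G.V × List G.A

/-- Left multiplication of a generator on a word. -/
noncomputable def act : CohnGen G → Word G → (Word G →₀ K)
  | vert v, (l, w, m) => if v = start l w then .single (l, w, m) 1 else 0
  | edge a, (l, w, m) => if G.r a = start l w then .single (a :: l, w, m) 1 else 0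
  | ghost a, ([], w, m) => if G.s a = w then .single ([], G.r a, a :: m) 1 else 0
  | ghost a, (b :: l, w, m) => if a = b ∧ G.r a = start l w then .single (l, w, m) 1 else 0

/-- The endomorphism of the space of words given by a generator. -/
noncomputable def actEnd (g : CohnGen G) : Module.End K (Word G →₀ K) :=
  Finsupp.linearCombination K (act K g)

@[simp] theorem actEnd_single (g : CohnGen G) (t : Word G) :
    actEnd K g (.single t 1) = act K g t := by
  simp [actEnd]

theorem lift_actEnd_rel {x y : FreeAlgebra K (CohnGen G)} (h : CohnRel K G x y) :
    FreeAlgebra.lift K (actEnd K) x = FreeAlgebra.lift K (actEnd K) y := by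
  refine Finsupp.lhom_ext' fun t => LinearMap.ext_ring ?_
  obtain ⟨l, w, m⟩ := t
  induction h <;> cases l <;>
    simp only [map_mul, FreeAlgebra.lift_ι_apply, apply_ite (FreeAlgebra.lift K (actEnd K)),
      map_zero, LinearMap.comp_apply, Finsupp.lsingle_apply, Module.End.mul_apply,
      actEnd_single, act] <;>
    split_ifs <;> simp_all [act] <;> grind

variable (G) in
/-- The representation of the Cohn path algebra on the space of words. -/
noncomputable def rep : CohnAlg K G →ₐ[K] Module.End K (Word G →₀ K) :=
  RingQuot.liftAlgHom K ⟨FreeAlgebra.lift K (actEnd K), fun _ _ h => lift_actEnd_rel K h⟩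

@[simp] theorem rep_gen (g : CohnGen G) : rep K G (gen K g) = actEnd K g := by
  simp [rep, gen]

theorem rep_ghosts {v w : G.V} {l : List G.A} (h : IsWalk G v l w) (m : List G.A) :
    rep K G (ghosts K l) (.single ([], v, m) 1) = .single ([], w, l.reverse ++ m) 1 := by
  induction l generalizing v m with
  | nil => cases h; simp
  | cons a l ih => simp [ghosts_cons, act, h.1, ih h.2]

theorem rep_edges {v w : G.V} {l : List G.A} (h : IsWalk G v l w) (m : List G.A) :
    rep K G (edges K l) (.single ([], w, m) 1) = .single (l, w, m) 1 := by
  induction l generalizing v with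
  | nil => simp
  | cons a l ih => simp [edges_cons, act, ih h.2, h.2.start_eq]

theorem rep_monomial (p q : FPath G) (h : p.rng = q.rng) (v : G.V) :
    rep K G (realElem K G p * ghostElem K G q) (.single ([], v, []) 1) =
      if q.src = v then .single (p.arrows, p.rng, q.arrows.reverse) 1 else 0 := by
  have hp := isWalk_fpath p
  have hq := isWalk_fpath q
  rw [← h] at hq
  rw [realElem_eq, ghostElem_eq]
  split_ifs with hv
  · subst hv
    simp [act, rep_ghosts K hq, rep_edges K hp, hp.start_eq]
  · simp [act, hv]

variable (G) in
theorem linearIndependent_monomials :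
    LinearIndependent K
      (fun pq : {pq : FPath G × FPath G // pq.1.rng = pq.2.rng} =>
        realElem K G pq.1.1 * ghostElem K G pq.1.2) := by
  classical
  let f (pq : {pq : FPath G × FPath G // pq.1.rng = pq.2.rng}) : Module.Dual K (CohnAlg K G) :=
    Finsupp.lapply (pq.1.1.arrows, pq.1.1.rng, pq.1.2.arrows.reverse) ∘ₗ
      LinearMap.applyₗ (.single ([], pq.1.2.src, []) 1) ∘ₗ (rep K G).toLinearMap
  have hf (i j) : f i (realElem K G j.1.1 * ghostElem K G j.1.2) = if j = i then 1 else 0 := by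
    simp only [f, LinearMap.comp_apply, AlgHom.toLinearMap_apply, LinearMap.applyₗ_apply_apply,
      rep_monomial K _ _ j.2, Finsupp.lapply_apply]
    by_cases hij : j = i
    · subst hij; simp
    · rw [if_neg hij]
      split_ifs
      · refine Finsupp.single_eq_of_ne fun h => hij ?_
        simp only [Prod.mk.injEq, List.reverse_inj] at h
        refine Subtype.ext (Prod.ext (fpath_ext h.1.symm h.2.1.symm)
          (fpath_ext h.2.2.symm ?_))
        rw [← i.2, ← j.2, h.2.1]
      · simp
  exact LinearIndependent.of_pairwise_dual_eq_zero_one _ f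
    (fun i j h => by simp [hf, h.symm]) (fun i => by simp [hf])

end Representation

end CohnAlg

/-- the family `{α β* : α, β finite paths with r(α) = r(β)}` is
a `K`-basis of the Cohn path algebra `C_K(E)`: it is linearly independent and
its span is `C_K(E)`, the non-unital subalgebra generated by the vertices,
arrows and ghost arrows. -/
theorem stmt16 (K : Type) [Field K] (G : Digraph') [DecidableEq G.V] [DecidableEq G.A] :
    LinearIndependent K
      (fun pq : {pq : FPath G × FPath G // pq.1.rng = pq.2.rng} =>
        realElem K G pq.1.1 * ghostElem K G pq.1.2)
    ∧ Submodule.span K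
        (Set.range fun pq : {pq : FPath G × FPath G // pq.1.rng = pq.2.rng} =>
          realElem K G pq.1.1 * ghostElem K G pq.1.2) =
      (NonUnitalAlgebra.adjoin K
        (Set.range fun g : CohnGen G =>
          RingQuot.mkAlgHom K (CohnRel K G) (FreeAlgebra.ι K g))).toSubmodule :=
  ⟨CohnAlg.linearIndependent_monomials K G, CohnAlg.monomialSpan_eq_adjoin K G⟩
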